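/- arXiv:1806.03979 — 5 statements merged into one kernel-verified Lean document; each statement's English description precedes it below -/
import Mathlib

section
/- Let X = μN + λB be a nowhere-zero isotropic vector field along α, where μ, λ : ℝ → ℝ are smooth. Then the Fermi–Walker derivative of X coincides with the ordinary derivative of X (∇̃_T X = X' identically) if and only if μ = 0 identically, i.e. X is everywhere a scalar multiple of the binormal B. -/
/-- The Galilean scalar product on `ℝ³`: `v₁w₁` if `v₁ ≠ 0` or `w₁ ≠ 0`,
and `v₂w₂ + v₃w₃` if `v₁ = 0` and `w₁ = 0`. -/
noncomputable def gProd (v w : Fin 3 → ℝ) : ℝ :=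
  if v 0 ≠ 0 ∨ w 0 ≠ 0 then v 0 * w 0 else v 1 * w 1 + v 2 * w 2

/-- The admissible curve `α(x) = (x, y(x), z(x))` in Galilean 3-space. -/
noncomputable def curve (y z : ℝ → ℝ) : ℝ → Fin 3 → ℝ :=
  fun x => ![x, y x, z x]

/-- The Fermi–Walker derivative along `α = curve y z`:
`∇̃_T X = X' − ⟨T,X⟩A + ⟨A,X⟩T`, where `T = α'` and `A = T' = α''`. -/
noncomputable def FW (y z : ℝ → ℝ) (X : ℝ → Fin 3 → ℝ) (x : ℝ) : Fin 3 → ℝ :=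
  deriv X x
    - gProd (deriv (curve y z) x) (X x) • deriv (deriv (curve y z)) x
    + gProd (deriv (deriv (curve y z)) x) (X x) • deriv (curve y z) x

/-- The tangent `T = α' = (1, y', z')`. -/
noncomputable def Tvec (y z : ℝ → ℝ) (x : ℝ) : Fin 3 → ℝ :=
  ![1, deriv y x, deriv z x]

/-- The curvature `κ = √(y''² + z''²)`. -/
noncomputable def kappa (y z : ℝ → ℝ) (x : ℝ) : ℝ :=
  Real.sqrt (deriv (deriv y) x ^ 2 + deriv (deriv z) x ^ 2)

/-- The principal normal `N = (1/κ)(0, y'', z'')`. -/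
noncomputable def Nvec (y z : ℝ → ℝ) (x : ℝ) : Fin 3 → ℝ :=
  (kappa y z x)⁻¹ • ![0, deriv (deriv y) x, deriv (deriv z) x]

/-- The binormal `B = (1/κ)(0, −z'', y'')`. -/
noncomputable def Bvec (y z : ℝ → ℝ) (x : ℝ) : Fin 3 → ℝ :=
  (kappa y z x)⁻¹ • ![0, -deriv (deriv z) x, deriv (deriv y) x]

/-- The torsion `τ = det(α', α'', α''') / κ²`. -/
noncomputable def tors (y z : ℝ → ℝ) (x : ℝ) : ℝ :=
  (Matrix.of ![![(1 : ℝ), deriv y x, deriv z x],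
    ![0, deriv (deriv y) x, deriv (deriv z) x],
    ![0, deriv (deriv (deriv y)) x, deriv (deriv (deriv z)) x]]).det / kappa y z x ^ 2

theorem deriv_curve {y z : ℝ → ℝ} (hy : Differentiable ℝ y) (hz : Differentiable ℝ z) :
    deriv (curve y z) = Tvec y z := by
  funext x
  refine HasDerivAt.deriv (hasDerivAt_pi.2 fun i => ?_)
  fin_cases i
  · exact hasDerivAt_id x
  · exact (hy x).hasDerivAt
  · exact (hz x).hasDerivAt

theorem deriv_Tvec {y z : ℝ → ℝ} (hy : Differentiable ℝ (deriv y))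
    (hz : Differentiable ℝ (deriv z)) (x : ℝ) :
    deriv (Tvec y z) x = ![0, deriv (deriv y) x, deriv (deriv z) x] := by
  refine HasDerivAt.deriv (hasDerivAt_pi.2 fun i => ?_)
  fin_cases i
  · exact hasDerivAt_const x 1
  · exact (hy x).hasDerivAt
  · exact (hz x).hasDerivAt

theorem sq_kappa (y z : ℝ → ℝ) (x : ℝ) :
    kappa y z x ^ 2 = deriv (deriv y) x ^ 2 + deriv (deriv z) x ^ 2 :=
  Real.sq_sqrt (by positivity)

theorem gProd_Tvec_normal_plane (y z : ℝ → ℝ) (a b x : ℝ) :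
    gProd (Tvec y z x) (a • Nvec y z x + b • Bvec y z x) = 0 := by
  simp [gProd, Tvec, Nvec, Bvec]

theorem gProd_acceleration_normal_plane {y z : ℝ → ℝ} {x : ℝ} (hκ : kappa y z x ≠ 0) (a b : ℝ) :
    gProd ![0, deriv (deriv y) x, deriv (deriv z) x] (a • Nvec y z x + b • Bvec y z x) =
      a * kappa y z x := by
  simp only [gProd, Nvec, Bvec, Pi.add_apply, Pi.smul_apply, smul_eq_mul, Matrix.cons_val,
    mul_zero, add_zero, ne_eq, not_true_eq_false, or_self, if_false]
  field_simp
  linear_combination -a * sq_kappa y z x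

theorem FW_normal_plane {y z : ℝ → ℝ} (hy : ContDiff ℝ 2 y) (hz : ContDiff ℝ 2 z)
    {X : ℝ → Fin 3 → ℝ} {a b x : ℝ} (hκ : kappa y z x ≠ 0)
    (hX : X x = a • Nvec y z x + b • Bvec y z x) :
    FW y z X x = deriv X x + (a * kappa y z x) • Tvec y z x := by
  rw [FW, deriv_curve (hy.differentiable (by norm_num)) (hz.differentiable (by norm_num)),
    deriv_Tvec hy.differentiable_deriv_two hz.differentiable_deriv_two, hX,
    gProd_Tvec_normal_plane, gProd_acceleration_normal_plane hκ, zero_smul, sub_zero]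

/-- For a nowhere-zero isotropic field `X = μN + λB` along `α`, the
Fermi–Walker derivative coincides with the ordinary derivative iff `μ = 0` identically,
i.e. `X` is everywhere a scalar multiple of the binormal `B`. -/
theorem fermiWalker_eq_deriv_iff_multiple_of_binormal
    (y z : ℝ → ℝ) (hy : ContDiff ℝ (⊤ : ℕ∞) y) (hz : ContDiff ℝ (⊤ : ℕ∞) z)
    (hκ : ∀ x, 0 < kappa y z x)
    (μ lam : ℝ → ℝ) (hμ : ContDiff ℝ (⊤ : ℕ∞) μ) (hlam : ContDiff ℝ (⊤ : ℕ∞) lam)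
    (X : ℝ → Fin 3 → ℝ)
    (hX : ∀ x, X x = μ x • Nvec y z x + lam x • Bvec y z x)
    (hXne : ∀ x, X x ≠ 0) :
    (∀ x : ℝ, FW y z X x = deriv X x) ↔ (∀ x : ℝ, μ x = 0) := by
  have hTne (x : ℝ) : Tvec y z x ≠ 0 := fun h => one_ne_zero (congrFun h 0)
  refine forall_congr' fun x => ?_
  rw [FW_normal_plane (contDiff_infty.1 hy 2) (contDiff_infty.1 hz 2) (hκ x).ne' (hX x)]
  simp [hTne x, (hκ x).ne']
end

section
/- Let X be a smooth vector field along α whose first component is nowhere zero (a non-isotropic vector field). Then the Fermi–Walker derivative of X does not coincide with the ordinary derivative of X: for every x, ∇̃_T X(x) ≠ X'(x). -/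
theorem hasDerivAt_vec3 {f g h : ℝ → ℝ} {f' g' h' x : ℝ} (hf : HasDerivAt f f' x)
    (hg : HasDerivAt g g' x) (hh : HasDerivAt h h' x) :
    HasDerivAt (fun t => ![f t, g t, h t]) ![f', g', h'] x := by
  rw [hasDerivAt_pi]
  intro i
  fin_cases i
  exacts [hf, hg, hh]

theorem gProd_of_right_ne_zero (v : Fin 3 → ℝ) {w : Fin 3 → ℝ} (hw : w 0 ≠ 0) :
    gProd v w = v 0 * w 0 :=
  if_pos (Or.inr hw)

theorem ContDiff.differentiable_deriv_of_smooth {f : ℝ → ℝ} (hf : ContDiff ℝ (⊤ : ℕ∞) f) :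
    Differentiable ℝ (deriv f) :=
  (contDiff_infty_iff_deriv.mp hf).2.differentiable (by simp)

/-- Along a non-isotropic field the Fermi–Walker derivative is `X' − X₁ A`. -/
theorem FW_eq_of_nonisotropic {y z : ℝ → ℝ} (hy : ContDiff ℝ (⊤ : ℕ∞) y)
    (hz : ContDiff ℝ (⊤ : ℕ∞) z) {X : ℝ → Fin 3 → ℝ} {x : ℝ} (hx : X x 0 ≠ 0) :
    FW y z X x = deriv X x - X x 0 • ![0, deriv (deriv y) x, deriv (deriv z) x] := by
  rw [FW, gProd_of_right_ne_zero _ hx, gProd_of_right_ne_zero _ hx,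
    deriv_curve (hy.differentiable (by simp)) (hz.differentiable (by simp)),
    deriv_Tvec hy.differentiable_deriv_of_smooth hz.differentiable_deriv_of_smooth]
  simp [Tvec]

/-- For a non-isotropic vector field `X` along `α` (first component nowhere
zero), the Fermi–Walker derivative never coincides with the ordinary derivative. -/
theorem fermiWalker_ne_deriv_of_nonisotropic
    (y z : ℝ → ℝ) (hy : ContDiff ℝ (⊤ : ℕ∞) y) (hz : ContDiff ℝ (⊤ : ℕ∞) z)
    (hκ : ∀ x, 0 < kappa y z x)
    (X : ℝ → Fin 3 → ℝ) (hX : ContDiff ℝ (⊤ : ℕ∞) X) (hXnoniso : ∀ x, X x 0 ≠ 0) :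
    ∀ x : ℝ, FW y z X x ≠ deriv X x := by
  intro x h
  rw [FW_eq_of_nonisotropic hy hz (hXnoniso x), sub_eq_self, smul_eq_zero_iff_right (hXnoniso x)]
    at h
  have hy0 : deriv (deriv y) x = 0 := congrFun h 1
  have hz0 : deriv (deriv z) x = 0 := congrFun h 2
  simpa [kappa, hy0, hz0] using hκ x
end

section
/- If X is a smooth vector field along α whose first component is identically zero (an isotropic vector field), then its Fermi–Walker derivative expressed in the Darboux frame satisfies ∇̃_T X = X' + (κ_g⟨Q, X⟩ + κ_n⟨n, X⟩) T at every point. -/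
theorem gProd_of_isotropic {v w : Fin 3 → ℝ} (hv : v 0 = 0) (hw : w 0 = 0) :
    gProd v w = v 1 * w 1 + v 2 * w 2 := by
  simp [gProd, hv, hw]

theorem gProd_of_isotropic_right_of_ne {v w : Fin 3 → ℝ} (hv : v 0 ≠ 0) (hw : w 0 = 0) :
    gProd v w = 0 := by
  simp [gProd, hv, hw]

/-- Parseval's identity for an orthonormal basis `(a, b)`, `(c, d)` of the plane. -/
theorem parseval_plane {a b c d : ℝ} (hab : a ^ 2 + b ^ 2 = 1) (hcd : c ^ 2 + d ^ 2 = 1)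
    (horth : a * c + b * d = 0) (p q u v : ℝ) :
    (p * a + q * b) * (a * u + b * v) + (p * c + q * d) * (c * u + d * v) =
      p * u + q * v := by
  have hc : c = -b * (a * d - b * c) := by linear_combination a * horth - c * hab
  have hd : d = a * (a * d - b * c) := by linear_combination b * horth - d * hab
  have hdet : (a * d - b * c) ^ 2 = 1 := by
    linear_combination (c ^ 2 + d ^ 2) * hab + hcd - (a * c + b * d) * horth
  generalize a * d - b * c = e at hc hd hdet
  subst hc hd
  linear_combination (p * u + q * v) * hab +
    (q * a - p * b) * (v * a - u * b) * hdet

/-- The product with an isotropic vector expands in an orthonormal isotropic frame. -/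
theorem gProd_eq_sum_frame {a q n v : Fin 3 → ℝ} (ha : a 0 = 0) (hq : q 0 = 0) (hn : n 0 = 0)
    (hv : v 0 = 0) (hqq : q 1 ^ 2 + q 2 ^ 2 = 1) (hnn : n 1 ^ 2 + n 2 ^ 2 = 1)
    (hqn : q 1 * n 1 + q 2 * n 2 = 0) :
    gProd a v = gProd a q * gProd q v + gProd a n * gProd n v := by
  rw [gProd_of_isotropic ha hv, gProd_of_isotropic ha hq, gProd_of_isotropic hq hv,
    gProd_of_isotropic ha hn, gProd_of_isotropic hn hv]
  exact (parseval_plane hqq hnn hqn _ _ _ _).symm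

/-- for an isotropic field `X` along `α`,
`∇̃_T X = X' + (κ_g⟨Q, X⟩ + κ_n⟨n, X⟩)T` at every point. -/
theorem fermiWalker_deriv_isotropic_darboux
(y z : ℝ → ℝ) (hy : ContDiff ℝ (⊤ : ℕ∞) y) (hz : ContDiff ℝ (⊤ : ℕ∞) z)
    (Q n : ℝ → Fin 3 → ℝ) (hQ : ContDiff ℝ (⊤ : ℕ∞) Q) (hn : ContDiff ℝ (⊤ : ℕ∞) n)
    (hQiso : ∀ x, Q x 0 = 0) (hniso : ∀ x, n x 0 = 0)
    (hQQ : ∀ x, Q x 1 ^ 2 + Q x 2 ^ 2 = 1)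
    (hnn : ∀ x, n x 1 ^ 2 + n x 2 ^ 2 = 1)
    (hQn : ∀ x, Q x 1 * n x 1 + Q x 2 * n x 2 = 0)
(kg kn : ℝ → ℝ)
    (hkg : ∀ x, kg x = gProd (deriv (deriv (curve y z)) x) (Q x))
    (hkn : ∀ x, kn x = gProd (deriv (deriv (curve y z)) x) (n x))
    (X : ℝ → Fin 3 → ℝ) (hX : ContDiff ℝ (⊤ : ℕ∞) X) (hXiso : ∀ x, X x 0 = 0) :
    ∀ x : ℝ, FW y z X x
      = deriv X x + (kg x * gProd (Q x) (X x) + kn x * gProd (n x) (X x)) • Tvec y z x := by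
  intro x
  have hT := deriv_curve (hy.differentiable (by simp)) (hz.differentiable (by simp))
  have hA := deriv_Tvec ((contDiff_infty_iff_deriv.1 hy).2.differentiable (by simp))
    ((contDiff_infty_iff_deriv.1 hz).2.differentiable (by simp)) x
  have hA0 : deriv (Tvec y z) x 0 = 0 := by simp [hA]
  have hTX : gProd (Tvec y z x) (X x) = 0 :=
    gProd_of_isotropic_right_of_ne (by simp [Tvec]) (hXiso x)
  rw [FW, hkg, hkn, hT, hTX, zero_smul, sub_zero,
    gProd_eq_sum_frame hA0 (hQiso x) (hniso x) (hXiso x) (hQQ x) (hnn x) (hQn x)]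
end

section
/- If X is a smooth vector field along α whose first component is nowhere zero (a non-isotropic vector field), then its Fermi–Walker derivative expressed in the Darboux frame satisfies ∇̃_T X = X' − ⟨T, X⟩(κ_g Q + κ_n n) at every point. -/
/-- Expansion of a plane vector `(a, b)` in an orthonormal basis `(p, q)`, `(u, v)` of `ℝ²`. -/
theorem orthonormal_plane_expansion {p q u v : ℝ} (hp : p ^ 2 + q ^ 2 = 1)
    (hu : u ^ 2 + v ^ 2 = 1) (hpu : p * u + q * v = 0) (a b : ℝ) :
    (a * p + b * q) * p + (a * u + b * v) * u = a ∧
      (a * p + b * q) * q + (a * u + b * v) * v = b := by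
  have hu' : u = -(p * v - q * u) * q := by linear_combination (-u) * hp + p * hpu
  have hv' : v = (p * v - q * u) * p := by linear_combination (-v) * hp + q * hpu
  have hd : (p * v - q * u) ^ 2 = 1 := by
    linear_combination (u ^ 2 + v ^ 2) * hp + hu - (p * u + q * v) * hpu
  generalize p * v - q * u = d at hu' hv' hd
  subst hu' hv'
  constructor
  · linear_combination (a * q ^ 2 - b * p * q) * hd + a * hp
  · linear_combination (b * p ^ 2 - a * p * q) * hd + b * hp

/-- for a non-isotropic field `X` along `α`,
`∇̃_T X = X' − ⟨T, X⟩(κ_g Q + κ_n n)` at every point. -/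
theorem fermiWalker_deriv_nonisotropic_darboux
(y z : ℝ → ℝ) (hy : ContDiff ℝ (⊤ : ℕ∞) y) (hz : ContDiff ℝ (⊤ : ℕ∞) z)
    (Q n : ℝ → Fin 3 → ℝ) (hQ : ContDiff ℝ (⊤ : ℕ∞) Q) (hn : ContDiff ℝ (⊤ : ℕ∞) n)
    (hQiso : ∀ x, Q x 0 = 0) (hniso : ∀ x, n x 0 = 0)
    (hQQ : ∀ x, Q x 1 ^ 2 + Q x 2 ^ 2 = 1)
    (hnn : ∀ x, n x 1 ^ 2 + n x 2 ^ 2 = 1)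
    (hQn : ∀ x, Q x 1 * n x 1 + Q x 2 * n x 2 = 0)
(kg kn : ℝ → ℝ)
    (hkg : ∀ x, kg x = gProd (deriv (deriv (curve y z)) x) (Q x))
    (hkn : ∀ x, kn x = gProd (deriv (deriv (curve y z)) x) (n x))
    (X : ℝ → Fin 3 → ℝ) (hX : ContDiff ℝ (⊤ : ℕ∞) X) (hXnoniso : ∀ x, X x 0 ≠ 0) :
    ∀ x : ℝ, FW y z X x
      = deriv X x - gProd (Tvec y z x) (X x) • (kg x • Q x + kn x • n x) := by
  intro x
  have differentiable_deriv {f : ℝ → ℝ} (hf : ContDiff ℝ (⊤ : ℕ∞) f) :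
      Differentiable ℝ (deriv f) :=
    (contDiff_infty_iff_deriv.1 hf).2.differentiable (by simp)
  have hA := deriv_Tvec (differentiable_deriv hy) (differentiable_deriv hz) x
  have hT := deriv_curve (hy.differentiable (by simp)) (hz.differentiable (by simp))
  rw [hT] at hkg hkn
  rw [FW, hT, hkg, hkn, hA]
  obtain ⟨h₁, h₂⟩ := orthonormal_plane_expansion (hQQ x) (hnn x) (hQn x)
    (deriv (deriv y) x) (deriv (deriv z) x)
  have hAX : gProd ![0, deriv (deriv y) x, deriv (deriv z) x] (X x) = 0 := by
    simp [gProd, hXnoniso x]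
  have hexp : gProd ![0, deriv (deriv y) x, deriv (deriv z) x] (Q x) • Q x
      + gProd ![0, deriv (deriv y) x, deriv (deriv z) x] (n x) • n x
      = ![0, deriv (deriv y) x, deriv (deriv z) x] := by
    funext i
    fin_cases i
    · simp [hQiso, hniso]
    · simpa [gProd, hQiso, hniso] using h₁
    · simpa [gProd, hQiso, hniso] using h₂
  rw [hAX, hexp, zero_smul, add_zero]
end

section
/- Let X be a smooth vector field along α whose first component is nowhere zero (a non-isotropic vector field). Then the Fermi–Walker derivative of X coincides with the ordinary derivative of X (∇̃_T X = X' identically) if and only if κ_g = 0 and κ_n = 0 identically, i.e. α is a line in G³. -/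
/-- Coordinates of a planar vector in an orthonormal basis `(p, q)`, `(r, s)` all vanish
exactly when the vector does. -/
theorem orthonormal_coords_eq_zero_iff {p q r s : ℝ} (hpq : p ^ 2 + q ^ 2 = 1)
    (hrs : r ^ 2 + s ^ 2 = 1) (h : p * r + q * s = 0) (a b : ℝ) :
    (a * p + b * q = 0 ∧ a * r + b * s = 0) ↔ a = 0 ∧ b = 0 := by
  constructor
  · rintro ⟨h₁, h₂⟩
    have hdet : (p * s - q * r) ^ 2 = 1 := by
      linear_combination (r ^ 2 + s ^ 2) * hpq + hrs - (p * r + q * s) * h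
    have hne : p * s - q * r ≠ 0 := by
      intro h0
      norm_num [h0] at hdet
    constructor
    · refine (mul_eq_zero.1 ?_).resolve_right hne
      linear_combination s * h₁ - q * h₂
    · refine (mul_eq_zero.1 ?_).resolve_right hne
      linear_combination p * h₂ - r * h₁
  · rintro ⟨rfl, rfl⟩
    simp

/-- for a non-isotropic field `X`, `∇̃_T X = X'` identically iff
`κ_g = 0` and `κ_n = 0` identically, i.e. `α` is a line in `G³`. -/
theorem fermiWalker_eq_deriv_iff_line_darboux
(y z : ℝ → ℝ) (hy : ContDiff ℝ (⊤ : ℕ∞) y) (hz : ContDiff ℝ (⊤ : ℕ∞) z)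
    (Q n : ℝ → Fin 3 → ℝ) (hQ : ContDiff ℝ (⊤ : ℕ∞) Q) (hn : ContDiff ℝ (⊤ : ℕ∞) n)
    (hQiso : ∀ x, Q x 0 = 0) (hniso : ∀ x, n x 0 = 0)
    (hQQ : ∀ x, Q x 1 ^ 2 + Q x 2 ^ 2 = 1)
    (hnn : ∀ x, n x 1 ^ 2 + n x 2 ^ 2 = 1)
    (hQn : ∀ x, Q x 1 * n x 1 + Q x 2 * n x 2 = 0)
(kg kn : ℝ → ℝ)
    (hkg : ∀ x, kg x = gProd (deriv (deriv (curve y z)) x) (Q x))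
    (hkn : ∀ x, kn x = gProd (deriv (deriv (curve y z)) x) (n x))
    (X : ℝ → Fin 3 → ℝ) (hX : ContDiff ℝ (⊤ : ℕ∞) X) (hXnoniso : ∀ x, X x 0 ≠ 0) :
    (∀ x : ℝ, FW y z X x = deriv X x) ↔ (∀ x : ℝ, kg x = 0 ∧ kn x = 0) := by
  have hT : deriv (curve y z) = Tvec y z :=
    deriv_curve (hy.differentiable (by simp)) (hz.differentiable (by simp))
  have hA : ∀ x, deriv (Tvec y z) x = ![0, deriv (deriv y) x, deriv (deriv z) x] :=
    deriv_Tvec (((contDiff_infty_iff_deriv.1 hy).2).differentiable (by simp))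
      (((contDiff_infty_iff_deriv.1 hz).2).differentiable (by simp))
  refine forall_congr' fun x => ?_
  have hκ : (kg x = 0 ∧ kn x = 0) ↔ deriv (deriv y) x = 0 ∧ deriv (deriv z) x = 0 := by
    rw [← orthonormal_coords_eq_zero_iff (hQQ x) (hnn x) (hQn x) (deriv (deriv y) x), hkg, hkn, hT, hA]
    simp [gProd, hQiso, hniso]
  have hFW : FW y z X x =
      deriv X x - X x 0 • ![0, deriv (deriv y) x, deriv (deriv z) x] := by
    simp [FW, hT, hA, gProd, Tvec, hXnoniso x]
  rw [hκ, hFW, sub_eq_self, smul_eq_zero, or_iff_right (hXnoniso x)]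
  simp [funext_iff, Fin.forall_fin_succ]
end
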